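/- For all 0 < a < 1, b < 1 and all integers n, x with 1 ≤ x ≤ n−1, one has lim_{q→0⁺} q^{−(n−x)(n−x−1)/2} · p_n^{a,b;q}(x) = (−a)^{n−x}/(1−a). -/

import Mathlib

open Finset Filter Topology

/-- The q-Pochhammer symbol `(c;q)_k = ∏_{j=0}^{k-1} (1 - c q^j)`. -/
noncomputable def qPoch (q c : ℝ) (k : ℕ) : ℝ := ∏ j ∈ Finset.range k, (1 - c * q ^ j)

/-- The little q-Jacobi function
`p_n^{a,b;q}(x) = ∑_{k=0}^{n} [(q^{−n};q)_k (a b q^{n−1};q)_k / ((a;q)_k (q;q)_k)] q^{k(x+1)}`. -/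
noncomputable def littleqJacobi (a b q : ℝ) (n x : ℕ) : ℝ :=
  ∑ k ∈ Finset.range (n + 1),
    qPoch q (q ^ (-(n : ℤ))) k * qPoch q (a * b * q ^ ((n : ℤ) - 1)) k
      / (qPoch q a k * qPoch q q k) * q ^ (k * (x + 1))

theorem qPoch_zero (q c : ℝ) : qPoch q c 0 = 1 := by simp [qPoch]

theorem qPoch_succ (q c : ℝ) (k : ℕ) : qPoch q c (k + 1) = qPoch q c k * (1 - c * q ^ k) := by
  simp [qPoch, Finset.prod_range_succ]

theorem qPoch_succ' (q c : ℝ) (k : ℕ) : qPoch q c (k + 1) = (1 - c) * qPoch q (c * q) k := by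
  simp only [qPoch, Finset.prod_range_succ']
  rw [mul_comm]
  congr 1
  · simp
  · apply Finset.prod_congr rfl
    intro j _
    ring

theorem qPoch_ne (q c : ℝ) (h : ∀ j : ℕ, 1 - c * q ^ j ≠ 0) (k : ℕ) : qPoch q c k ≠ 0 :=
  Finset.prod_ne_zero_iff.mpr fun j _ => h j

/-- coefficients -/
noncomputable def cf (q r s a : ℝ) (k : ℕ) : ℝ :=
  qPoch q r k * qPoch q s k / (qPoch q a k * qPoch q q k)

theorem cf_zero (q r s a : ℝ) : cf q r s a 0 = 1 := by simp [cf, qPoch_zero]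

theorem cf_succ (q r s a : ℝ) (k : ℕ) (ha : ∀ j : ℕ, 1 - a * q ^ j ≠ 0)
    (hq : ∀ j : ℕ, 1 - q * q ^ j ≠ 0) :
    cf q r s a (k + 1) * (1 - a * q ^ k) * (1 - q * q ^ k)
      = cf q r s a k * (1 - r * q ^ k) * (1 - s * q ^ k) := by
  have h1 := qPoch_ne q a ha k
  have h2 := qPoch_ne q q hq k
  have h3 := ha k
  have h4 := hq k
  simp only [cf, qPoch_succ]
  generalize 1 - a * q ^ k = A at *
  generalize 1 - q * q ^ k = B at *
  field_simp

theorem cf_diff (q r s a : ℝ) (k : ℕ) (ha : ∀ j : ℕ, 1 - a * q ^ j ≠ 0)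
    (hq : ∀ j : ℕ, 1 - q * q ^ j ≠ 0) :
    cf q r s a (k + 1) = cf q (r * q) s a (k + 1)
      - r * ((1 - s) / (1 - a)) * cf q (r * q) (s * q) (a * q) k := by
  have ha' : ∀ j : ℕ, 1 - a * q * q ^ j ≠ 0 := by
    intro j
    have := ha (j + 1)
    rwa [pow_succ', ← mul_assoc] at this
  have h1 := qPoch_ne q (a * q) ha' k
  have h2 := qPoch_ne q q hq k
  have h3 : 1 - a ≠ 0 := by simpa using ha 0
  have h4 := hq k
  simp only [cf]
  rw [qPoch_succ' q r, qPoch_succ q (r * q), qPoch_succ' q s, qPoch_succ' q a, qPoch_succ q q]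
  field_simp
  ring

theorem chu (q : ℝ) (hq0 : q ≠ 0) (hq : ∀ j : ℕ, 1 - q * q ^ j ≠ 0) (n : ℕ) :
    ∀ (s a : ℝ), (∀ j : ℕ, 1 - a * q ^ j ≠ 0) →
    ∑ k ∈ Finset.range (n + 1), cf q (q ^ n)⁻¹ s a k * q ^ k
      = (∏ j ∈ Finset.range n, (s - a * q ^ j)) / qPoch q a n := by
  induction n with
  | zero => intro s a _; simp [cf, qPoch_zero]
  | succ n ih =>
    intro s a ha
    have ha' : ∀ j : ℕ, 1 - a * q * q ^ j ≠ 0 := by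
      intro j
      have := ha (j + 1)
      rwa [pow_succ', ← mul_assoc] at this
    have hr : (q ^ (n + 1))⁻¹ * q = (q ^ n)⁻¹ := by rw [pow_succ]; field_simp
    have hlast : cf q (q ^ n)⁻¹ s a (n + 1) = 0 := by
      have : (1 - (q ^ n)⁻¹ * q ^ n) = 0 := by field_simp; simp
      simp [cf, qPoch_succ q (q ^ n)⁻¹, this]
    have i1 := ih s a ha
    have i2 := ih (s * q) (a * q) ha'
    rw [Finset.sum_range_succ']
    have : ∀ k ∈ Finset.range (n + 1), cf q (q ^ (n + 1))⁻¹ s a (k + 1) * q ^ (k + 1)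
        = cf q (q ^ n)⁻¹ s a (k + 1) * q ^ (k + 1)
          - (q ^ n)⁻¹ * ((1 - s) / (1 - a)) * (cf q (q ^ n)⁻¹ (s * q) (a * q) k * q ^ k) := by
      intro k _
      rw [cf_diff q (q ^ (n + 1))⁻¹ s a k ha hq, hr, ← hr]
      ring
    rw [Finset.sum_congr rfl this, Finset.sum_sub_distrib, ← Finset.mul_sum, i2]
    have e : ∑ k ∈ Finset.range (n + 1), cf q (q ^ n)⁻¹ s a (k + 1) * q ^ (k + 1)
        = (∏ j ∈ Finset.range n, (s - a * q ^ j)) / qPoch q a n - 1 := by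
      rw [← i1, Finset.sum_range_succ, hlast,
        Finset.sum_range_succ' (fun k => cf q (q ^ n)⁻¹ s a k * q ^ k)]
      simp [cf_zero]
    rw [e, cf_zero]
    have p : ∏ j ∈ Finset.range n, (s * q - a * q * q ^ j)
        = q ^ n * ∏ j ∈ Finset.range n, (s - a * q ^ j) := by
      rw [Finset.prod_congr rfl (fun j _ => show s * q - a * q * q ^ j = q * (s - a * q ^ j) by ring),
        Finset.prod_mul_distrib]
      simp
    rw [p, Finset.prod_range_succ]
    have h1 := qPoch_ne q (a * q) ha' n
    have h2 := qPoch_ne q a ha n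
    have h3 : 1 - a ≠ 0 := by simpa using ha 0
    have h4 := ha n
    have h5 : qPoch q a n * (1 - a * q ^ n) = (1 - a) * qPoch q (a * q) n := by
      rw [← qPoch_succ, qPoch_succ']
    have h6 : qPoch q (a * q) n = qPoch q a n * (1 - a * q ^ n) / (1 - a) := by
      rw [h5]; field_simp
    rw [qPoch_succ, h6]
    field_simp
    ring

theorem partialsum (q r s a X : ℝ) (ha : ∀ j : ℕ, 1 - a * q ^ j ≠ 0)
    (hq : ∀ j : ℕ, 1 - q * q ^ j ≠ 0) (N : ℕ) :
    ∑ k ∈ Finset.range N, cf q r s a k * X ^ k *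
      ((q * r * s * X - a) * ((q ^ k) ^ 2 - q ^ k) + q * (X - 1) * (1 - q ^ k)
        - X * q * (r - 1) * (1 - s) * q ^ k)
      = cf q r s a N * (1 - q ^ N) * (q - a * q ^ N) * X ^ N := by
  induction N with
  | zero => simp
  | succ N ih =>
    rw [Finset.sum_range_succ, ih]
    have h := cf_succ q r s a N ha hq
    rw [pow_succ q N, pow_succ X N]
    linear_combination (-q * X ^ N * X) * h

/-- generating polynomial -/
noncomputable def Yf (q r s a : ℝ) (n : ℕ) (z : ℝ) : ℝ :=
  ∑ k ∈ Finset.range (n + 1), cf q r s a k * z ^ k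

theorem Y_eq (q s a X : ℝ) (n : ℕ) (hq0 : q ≠ 0) (ha : ∀ j : ℕ, 1 - a * q ^ j ≠ 0)
    (hq : ∀ j : ℕ, 1 - q * q ^ j ≠ 0) :
    (q * (q ^ n)⁻¹ * s * X - a) * (Yf q (q ^ n)⁻¹ s a n (q ^ 2 * X) - Yf q (q ^ n)⁻¹ s a n (q * X))
     + q * (X - 1) * (Yf q (q ^ n)⁻¹ s a n X - Yf q (q ^ n)⁻¹ s a n (q * X))
      = X * q * ((q ^ n)⁻¹ - 1) * (1 - s) * Yf q (q ^ n)⁻¹ s a n (q * X) := by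
  have h := partialsum q (q ^ n)⁻¹ s a X ha hq (n + 1)
  have hlast : cf q (q ^ n)⁻¹ s a (n + 1) = 0 := by
    have : (1 - (q ^ n)⁻¹ * q ^ n) = 0 := by field_simp; simp
    simp [cf, qPoch_succ q (q ^ n)⁻¹, this]
  rw [hlast] at h
  simp only [zero_mul] at h
  rw [← sub_eq_zero, ← h]
  simp only [Yf, ← Finset.sum_sub_distrib, Finset.mul_sum, ← Finset.sum_add_distrib]
  apply Finset.sum_congr rfl
  intro k _
  rw [mul_pow, mul_pow, ← pow_mul, mul_comm 2 k, pow_mul]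
  ring

theorem lqJ_eq (a b q : ℝ) (n x : ℕ) (hn : 1 ≤ n) :
    littleqJacobi a b q n x = Yf q (q ^ n)⁻¹ (a * b * q ^ (n - 1)) a n (q ^ (x + 1)) := by
  have : (n : ℤ) - 1 = ((n - 1 : ℕ) : ℤ) := by omega
  simp only [littleqJacobi, Yf, cf, this, zpow_neg, zpow_natCast]
  apply Finset.sum_congr rfl
  intro k _
  rw [← pow_mul, mul_comm k]

theorem tendsto_qPoch (c : ℝ) (n : ℕ) (hn : 1 ≤ n) :
    Tendsto (fun q => qPoch q c n) (𝓝[Set.Ioo (0 : ℝ) 1] 0) (𝓝 (1 - c)) := by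
  have hc : Continuous (fun q => qPoch q c n) := by unfold qPoch; fun_prop
  have h0 : qPoch 0 c n = 1 - c := by
    obtain ⟨m, rfl⟩ : ∃ m, n = m + 1 := ⟨n - 1, by omega⟩
    rw [qPoch_succ']; simp [qPoch]
  have := hc.tendsto 0
  rw [h0] at this
  exact this.mono_left nhdsWithin_le_nhds

theorem ne_aux (c q : ℝ) (hc0 : 0 < c) (hc : c < 1) (hq0 : 0 < q) (hq1 : q < 1) (j : ℕ) :
    1 - c * q ^ j ≠ 0 := by
  have h1 : q ^ j ≤ 1 := pow_le_one₀ hq0.le hq1.le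
  have h2 : 0 < q ^ j := pow_pos hq0 j
  nlinarith

theorem lqJ_zero (a b q : ℝ) (n : ℕ) (hn : 1 ≤ n) (ha0 : 0 < a) (ha1 : a < 1)
    (hq0 : 0 < q) (hq1 : q < 1) :
    littleqJacobi a b q n 0 = q ^ (n.choose 2) * ((-a) ^ n * qPoch q b n / qPoch q a n) := by
  rw [lqJ_eq _ _ _ _ _ hn, Yf]
  simp only [zero_add, pow_one]
  rw [chu q hq0.ne' (ne_aux q q hq0 hq1 hq0 hq1) n _ a (ne_aux a q ha0 ha1 hq0 hq1)]
  rw [← mul_div_assoc]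
  congr 1
  have e : ∀ j ∈ Finset.range n, a * b * q ^ (n - 1) - a * q ^ j
      = (-a) * q ^ j * (1 - b * q ^ (n - 1 - j)) := by
    intro j hj
    have : n - 1 = j + (n - 1 - j) := by have := Finset.mem_range.mp hj; omega
    conv_lhs => rw [this, pow_add]
    ring
  rw [Finset.prod_congr rfl e, Finset.prod_mul_distrib, Finset.prod_mul_distrib,
    Finset.prod_range_reflect (fun j => 1 - b * q ^ j) n, Finset.prod_pow_eq_pow_sum,
    Finset.sum_range_id, Nat.choose_two_right]
  simp [qPoch]
  ring

/-- recurrence in `x`, normalised: `M + 1 = n - (x+1)` -/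
theorem lqJ_rec (a b q : ℝ) (n x M : ℕ) (hn : n = x + 1 + M + 1) (ha0 : 0 < a) (ha1 : a < 1)
    (hq0 : 0 < q) (hq1 : q < 1) :
    q ^ M * (a * (b * q ^ (x + 1) - 1)) * littleqJacobi a b q n (x + 2)
     = (q ^ M * (a * (b * q ^ (x + 1) - 1) + q * (q ^ (x + 1) - 1))
        + (1 - q ^ n) * (1 - a * b * q ^ (n - 1))) * littleqJacobi a b q n (x + 1)
       - q ^ M * q * (q ^ (x + 1) - 1) * littleqJacobi a b q n x := by
  have h := Y_eq q (a * b * q ^ (n - 1)) a (q ^ (x + 1)) n hq0.ne'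
    (ne_aux a q ha0 ha1 hq0 hq1) (ne_aux q q hq0 hq1 hq0 hq1)
  have hn1 : 1 ≤ n := by omega
  rw [← pow_add, ← pow_succ', show 2 + (x + 1) = x + 2 + 1 by ring, ← lqJ_eq a b q n x hn1,
    ← lqJ_eq a b q n (x + 2) hn1, ← lqJ_eq a b q n (x + 1) hn1] at h
  have h1 : q * (q ^ n)⁻¹ * (a * b * q ^ (n - 1)) = a * b := by
    obtain ⟨m, rfl⟩ : ∃ m, n = m + 1 := ⟨n - 1, by omega⟩
    simp only [Nat.add_sub_cancel, pow_succ]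
    field_simp
  have h2 : q ^ M * q ^ (x + 1) * q * (q ^ n)⁻¹ = 1 := by
    have : q ^ M * q ^ (x + 1) * q = q ^ n := by rw [hn]; ring
    rw [this]; field_simp
  have h3 : q ^ M * q ^ (x + 1) * q = q ^ n := by rw [hn]; ring
  rw [h1] at h
  linear_combination q ^ M * h + (1 - a * b * q ^ (n - 1)) * littleqJacobi a b q n (x + 1) * (h2 - h3)

theorem lqJ_rec0 (a b q : ℝ) (n M : ℕ) (hn : n = M + 1) (ha0 : 0 < a) (ha1 : a < 1)
    (hq0 : 0 < q) (hq1 : q < 1) :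
    q ^ M * (a * (b - 1)) * littleqJacobi a b q n 1
     = (q ^ M * (a * (b - 1))
        + (1 - q ^ n) * (1 - a * b * q ^ (n - 1))) * littleqJacobi a b q n 0 := by
  have h := Y_eq q (a * b * q ^ (n - 1)) a 1 n hq0.ne'
    (ne_aux a q ha0 ha1 hq0 hq1) (ne_aux q q hq0 hq1 hq0 hq1)
  have hn1 : 1 ≤ n := by omega
  have e0 := lqJ_eq a b q n 0 hn1
  have e1 := lqJ_eq a b q n 1 hn1
  simp only [zero_add, pow_one, Nat.reduceAdd] at e0 e1
  rw [mul_one (q ^ 2), mul_one q, ← e0, ← e1] at h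
  have h1 : q * (q ^ n)⁻¹ * (a * b * q ^ (n - 1)) = a * b := by
    subst hn
    simp only [Nat.add_sub_cancel, pow_succ]
    field_simp
  have h3 : q ^ M * q = q ^ n := by rw [hn]; ring
  have h2 : q ^ M * q * (q ^ n)⁻¹ = 1 := by
    rw [h3]; field_simp
  rw [mul_one, h1] at h
  linear_combination q ^ M * h + (1 - a * b * q ^ (n - 1)) * littleqJacobi a b q n 0 * (h2 - h3)

theorem tendsto_cont (f : ℝ → ℝ) (hf : Continuous f) (L : ℝ) (h : f 0 = L) :
    Tendsto f (𝓝[Set.Ioo (0 : ℝ) 1] 0) (𝓝 L) := by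
  rw [← h]
  exact (hf.tendsto 0).mono_left nhdsWithin_le_nhds

theorem ev_Ioo : ∀ᶠ q : ℝ in 𝓝[Set.Ioo (0 : ℝ) 1] 0, 0 < q ∧ q < 1 := by
  filter_upwards [self_mem_nhdsWithin] with q hq using hq

theorem lim0 (a b : ℝ) (ha0 : 0 < a) (ha1 : a < 1) (n : ℕ) (hn : 1 ≤ n) :
    Tendsto (fun q : ℝ => littleqJacobi a b q n 0 / q ^ (n.choose 2))
      (𝓝[Set.Ioo (0 : ℝ) 1] 0) (𝓝 ((-a) ^ n * (1 - b) / (1 - a))) := by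
  have h := ((tendsto_qPoch b n hn).const_mul ((-a) ^ n)).div (tendsto_qPoch a n hn)
    (by linarith)
  refine h.congr' ?_
  filter_upwards [ev_Ioo] with q hq
  rw [lqJ_zero a b q n hn ha0 ha1 hq.1 hq.2]
  have : q ^ (n.choose 2) ≠ 0 := pow_ne_zero _ hq.1.ne'
  simp only [Pi.div_apply]
  field_simp

theorem choose_two_succ (m : ℕ) : (m + 1).choose 2 = m + m.choose 2 := by
  rw [Nat.choose_succ_succ' m 1]; simp

theorem lim1 (a b : ℝ) (ha0 : 0 < a) (ha1 : a < 1) (hb : b < 1) (M : ℕ) (hM : 1 ≤ M) :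
    Tendsto (fun q : ℝ => littleqJacobi a b q (M + 1) 1 / q ^ (M.choose 2))
      (𝓝[Set.Ioo (0 : ℝ) 1] 0) (𝓝 ((-a) ^ M / (1 - a))) := by
  have h0 := lim0 a b ha0 ha1 (M + 1) (by omega)
  have hb' : b - 1 ≠ 0 := by linarith
  have hc : Tendsto (fun q : ℝ => (q ^ M * (a * (b - 1))
        + (1 - q ^ (M + 1)) * (1 - a * b * q ^ M)) / (a * (b - 1)))
      (𝓝[Set.Ioo (0 : ℝ) 1] 0) (𝓝 (1 / (a * (b - 1)))) := by
    apply tendsto_cont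
    · fun_prop
    · have : M ≠ 0 := by omega
      simp [this]
  have h := hc.mul h0
  have hL : 1 / (a * (b - 1)) * ((-a) ^ (M + 1) * (1 - b) / (1 - a)) = (-a) ^ M / (1 - a) := by
    have : 1 - a ≠ 0 := by linarith
    field_simp
    ring
  rw [hL] at h
  refine h.congr' ?_
  filter_upwards [ev_Ioo] with q hq
  have hr := lqJ_rec0 a b q (M + 1) M rfl ha0 ha1 hq.1 hq.2
  simp only [Nat.add_sub_cancel] at hr
  have hq0 := hq.1.ne'
  rw [choose_two_succ, pow_add q M (M.choose 2), div_mul_div_comm, ← hr]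
  field_simp

theorem lim_step (a b : ℝ) (ha0 : 0 < a) (ha1 : a < 1) (x M : ℕ) (hM : 1 ≤ M) (L K : ℝ)
    (h0 : Tendsto (fun q : ℝ => littleqJacobi a b q (x + 1 + M + 1) x / q ^ ((M + 2).choose 2))
      (𝓝[Set.Ioo (0 : ℝ) 1] 0) (𝓝 L))
    (h1 : Tendsto (fun q : ℝ => littleqJacobi a b q (x + 1 + M + 1) (x + 1)
        / q ^ ((M + 1).choose 2)) (𝓝[Set.Ioo (0 : ℝ) 1] 0) (𝓝 K)) :
    Tendsto (fun q : ℝ => littleqJacobi a b q (x + 1 + M + 1) (x + 2) / q ^ (M.choose 2))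
      (𝓝[Set.Ioo (0 : ℝ) 1] 0) (𝓝 (K / (-a))) := by
  have hMne : M ≠ 0 := by omega
  have hden : Tendsto (fun q : ℝ => a * (b * q ^ (x + 1) - 1))
      (𝓝[Set.Ioo (0 : ℝ) 1] 0) (𝓝 (-a)) := by
    apply tendsto_cont
    · fun_prop
    · simp
  have hc : Tendsto (fun q : ℝ => q ^ M * (a * (b * q ^ (x + 1) - 1) + q * (q ^ (x + 1) - 1))
        + (1 - q ^ (x + 1 + M + 1)) * (1 - a * b * q ^ (x + 1 + M)))
      (𝓝[Set.Ioo (0 : ℝ) 1] 0) (𝓝 1) := by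
    apply tendsto_cont
    · fun_prop
    · simp [hMne]
  have hd : Tendsto (fun q : ℝ => q ^ (M + 1) * q ^ M * q * (q ^ (x + 1) - 1))
      (𝓝[Set.Ioo (0 : ℝ) 1] 0) (𝓝 0) := by
    apply tendsto_cont
    · fun_prop
    · simp
  have h := ((hc.mul h1).sub (hd.mul h0)).div hden (by linarith)
  have hL : (1 * K - 0 * L) / (-a) = K / (-a) := by ring
  rw [hL] at h
  refine h.congr' ?_
  have hne : ∀ᶠ q : ℝ in 𝓝[Set.Ioo (0 : ℝ) 1] 0, a * (b * q ^ (x + 1) - 1) ≠ 0 :=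
    hden.eventually_ne (by linarith)
  filter_upwards [ev_Ioo, hne] with q hq hqn
  have hr := lqJ_rec a b q (x + 1 + M + 1) x M rfl ha0 ha1 hq.1 hq.2
  simp only [Nat.add_sub_cancel] at hr
  have hq0 := hq.1.ne'
  simp only [Pi.div_apply]
  rw [div_eq_iff hqn, choose_two_succ (M + 1), choose_two_succ M,
    pow_add q (M + 1) (M + M.choose 2), pow_add q M (M.choose 2)]
  have hp : q ^ (M.choose 2) ≠ 0 := pow_ne_zero _ hq0
  have hp1 : q ^ M ≠ 0 := pow_ne_zero _ hq0
  have hp2 : q ^ (M + 1) ≠ 0 := pow_ne_zero _ hq0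
  generalize littleqJacobi a b q (x + 1 + M + 1) (x + 2) = y2 at *
  generalize littleqJacobi a b q (x + 1 + M + 1) (x + 1) = y1 at *
  generalize littleqJacobi a b q (x + 1 + M + 1) x = y0 at *
  generalize (q ^ M * (a * (b * q ^ (x + 1) - 1) + q * (q ^ (x + 1) - 1))
        + (1 - q ^ (x + 1 + M + 1)) * (1 - a * b * q ^ (x + 1 + M))) = A at *
  generalize a * (b * q ^ (x + 1) - 1) = B at *
  generalize q ^ (x + 1) - 1 = C at *
  generalize q ^ (M + 1) = P at *
  generalize q ^ M = Q at *
  generalize q ^ (M.choose 2) = R at *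
  field_simp
  linear_combination -hr

theorem lim_all (a b : ℝ) (ha0 : 0 < a) (ha1 : a < 1) (hb : b < 1) (x : ℕ) :
    ∀ M : ℕ, 1 ≤ M →
    (∃ L, Tendsto (fun q : ℝ => littleqJacobi a b q (x + 1 + M) x / q ^ ((M + 1).choose 2))
      (𝓝[Set.Ioo (0 : ℝ) 1] 0) (𝓝 L)) ∧
    Tendsto (fun q : ℝ => littleqJacobi a b q (x + 1 + M) (x + 1) / q ^ (M.choose 2))
      (𝓝[Set.Ioo (0 : ℝ) 1] 0) (𝓝 ((-a) ^ M / (1 - a))) := by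
  induction x with
  | zero =>
    intro M hM
    rw [show 0 + 1 + M = M + 1 by ring]
    exact ⟨⟨_, lim0 a b ha0 ha1 (M + 1) (by omega)⟩, lim1 a b ha0 ha1 hb M hM⟩
  | succ x ih =>
    intro M hM
    obtain ⟨⟨L, hL⟩, hK⟩ := ih (M + 1) (by omega)
    have e : x + 1 + 1 + M = x + 1 + M + 1 := by ring
    rw [e]
    refine ⟨⟨_, hK⟩, ?_⟩
    have := lim_step a b ha0 ha1 x M hM L _ hL hK
    convert this using 2
    have : 1 - a ≠ 0 := by linarith
    field_simp
    ring

theorem littleqJacobi_asymptotics_zero (a b : ℝ) (ha0 : 0 < a) (ha1 : a < 1) (hb : b < 1)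
    (n x : ℕ) (hx1 : 1 ≤ x) (hxn : x ≤ n - 1) :
    Tendsto
      (fun q : ℝ => q ^ (-(((n - x) * (n - x - 1) / 2 : ℕ) : ℤ)) * littleqJacobi a b q n x)
      (𝓝[Set.Ioo (0 : ℝ) 1] 0) (𝓝 ((-a) ^ (n - x) / (1 - a))) := by
  obtain ⟨y, rfl⟩ : ∃ y, x = y + 1 := ⟨x - 1, by omega⟩
  obtain ⟨M, rfl⟩ : ∃ M, n = y + 1 + M := ⟨n - (y + 1), by omega⟩
  have h := (lim_all a b ha0 ha1 hb y M (by omega)).2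
  rw [show y + 1 + M - (y + 1) = M by omega, ← Nat.choose_two_right]
  refine h.congr ?_
  intro q
  rw [zpow_neg, zpow_natCast, div_eq_inv_mul]
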